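/- (Ho, non-expandability of two-move games.) Let a < b be coprime positive integers with b > 2a, and if a = 1 assume b is even. Let S = {a, b}. Then S is non-expandable: a positive integer c satisfies G_{S ∪ {c}}(n) = G_S(n) for all n (i.e. adjoining the move c does not alter the nim-value sequence) if and only if c = a + n(a + b) or c = b + n(a + b) for some n ∈ ℕ. -/

import Mathlib

/-- Nim-value (Sprague–Grundy value) of the subtraction game on `S`:
`subG S n = mex { subG S (n - s) : s ∈ S, s ≤ n }` (moves are positive). -/
noncomputable def subG (S : Finset ℕ) : ℕ → ℕ
  | n => sInf {k : ℕ | ∀ s ∈ S, ∀ (hs : 0 < s) (hn : s ≤ n), subG S (n - s) ≠ k}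
  decreasing_by exact Nat.sub_lt (Nat.lt_of_lt_of_le hs hn) hs

theorem subG_sub_ne (S : Finset ℕ) {n s : ℕ} (hS : s ∈ S) (hs : 0 < s) (hn : s ≤ n) :
    subG S (n - s) ≠ subG S n := by
  have hne : {k : ℕ | ∀ s ∈ S, ∀ (_ : 0 < s) (_ : s ≤ n), subG S (n - s) ≠ k}.Nonempty := by
    refine ⟨S.sup (fun s => subG S (n - s)) + 1, fun s hs _ _ => ?_⟩
    have := Finset.le_sup (f := fun s => subG S (n - s)) hs
    omega
  have h := Nat.sInf_mem hne s hS hs hn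
  rwa [← subG.eq_1] at h

theorem exists_subG_sub_eq (S : Finset ℕ) {n k : ℕ} (hk : k < subG S n) :
    ∃ s ∈ S, 0 < s ∧ s ≤ n ∧ subG S (n - s) = k := by
  rw [subG.eq_1] at hk
  have h := Nat.notMem_of_lt_sInf hk
  simp only [Set.mem_ofPred_eq, not_forall, not_not] at h
  obtain ⟨s, hs, h0, hn, h⟩ := h
  exact ⟨s, hs, h0, hn, h⟩

/-- A function satisfying the mex recursion is the nim-value function. -/
theorem subG_eq_of_mex (S : Finset ℕ) (F : ℕ → ℕ)
    (hne : ∀ n, ∀ s ∈ S, 0 < s → s ≤ n → F (n - s) ≠ F n)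
    (hex : ∀ n, ∀ k < F n, ∃ s ∈ S, 0 < s ∧ s ≤ n ∧ F (n - s) = k) (n : ℕ) :
    subG S n = F n := by
  induction n using Nat.strong_induction_on with
  | _ n ih =>
    apply le_antisymm
    · by_contra! h
      obtain ⟨s, hS, hs, hn, h⟩ := exists_subG_sub_eq S h
      rw [ih _ (by omega)] at h
      exact hne n s hS hs hn h
    · by_contra! h
      obtain ⟨s, hS, hs, hn, h⟩ := hex n _ h
      rw [← ih _ (by omega)] at h
      exact subG_sub_ne S hS hs hn h

theorem subG_insert_eq_iff (S : Finset ℕ) {c : ℕ} (hc : 0 < c) :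
    (∀ n, subG (insert c S) n = subG S n) ↔ ∀ m, subG S m ≠ subG S (m + c) := by
  constructor
  · intro h m
    have := subG_sub_ne (insert c S) (Finset.mem_insert_self c S) hc (Nat.le_add_left c m)
    simpa [h] using this
  · intro h
    refine subG_eq_of_mex _ _ (fun n s hS hs hn => ?_) (fun n k hk => ?_)
    · rcases Finset.mem_insert.1 hS with rfl | hS
      · simpa [Nat.sub_add_cancel hn] using h (n - s)
      · exact subG_sub_ne S hS hs hn
    · obtain ⟨s, hS, h⟩ := exists_subG_sub_eq S hk
      exact ⟨s, Finset.mem_insert_of_mem hS, h⟩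

/-- The nim-values of the game `{a, b}` on one period `[0, a + b)`. -/
def twoMoveBlock (a b r : ℕ) : ℕ :=
  if r < b then (r / a) % 2 else 1 + (r / a + 1) % 2

theorem subG_pair {a b : ℕ} (ha : 0 < a) (hb : 2 * a < b) (n : ℕ) :
    subG {a, b} n = twoMoveBlock a b (n % (a + b)) := by
  have hmod : ∀ q r, r < a + b → (r + (a + b) * q) % (a + b) = r := fun q r hr => by
    rw [Nat.add_mul_mod_self_left, Nat.mod_eq_of_lt hr]
  have hdiv : ∀ r, (r + a) / a = r / a + 1 := fun r => Nat.add_div_right r ha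
  have hsmall : ∀ r, r < a → r / a = 0 := fun r hr => Nat.div_eq_of_lt hr
  have hn : ∀ n, ∃ q r, r < a + b ∧ n = r + (a + b) * q := fun n =>
    ⟨n / (a + b), n % (a + b), Nat.mod_lt _ (by omega), (Nat.mod_add_div n (a + b)).symm⟩
  have hback : ∀ q r s, s ≤ a + b → r < s → s ≤ r + (a + b) * q →
      (r + (a + b) * q - s) % (a + b) = r + (a + b) - s := fun q r s hs hr h => by
    obtain _ | q := q
    · omega
    · rw [show r + (a + b) * (q + 1) - s = (r + (a + b) - s) + (a + b) * q by
        rw [Nat.mul_succ]; omega]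
      exact hmod _ _ (by omega)
  have hfwd : ∀ q r s, r < a + b → s ≤ r →
      (r + (a + b) * q - s) % (a + b) = r - s := fun q r s hr hs => by
    rw [show r + (a + b) * q - s = (r - s) + (a + b) * q by omega]
    exact hmod _ _ (by omega)
  refine subG_eq_of_mex _ (fun n => twoMoveBlock a b (n % (a + b))) ?_ ?_ n
  · intro n s hS _ hsn
    obtain ⟨q, r, hr, rfl⟩ := hn n
    simp only [hmod q r hr]
    simp only [Finset.mem_insert, Finset.mem_singleton] at hS
    rcases hS with rfl | rfl
    · rcases lt_or_ge r s with h | h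
      · rw [hback q r s (by omega) h hsn]
        simp only [twoMoveBlock, hsmall r h]
        split_ifs <;> omega
      · rw [hfwd q r s hr h]
        obtain ⟨t, rfl⟩ := Nat.exists_eq_add_of_le' h
        simp only [twoMoveBlock, hdiv, Nat.add_sub_cancel]
        split_ifs <;> omega
    · rcases lt_or_ge r s with h | h
      · rw [hback q r s (by omega) h hsn, show r + (a + s) - s = r + a by omega]
        simp only [twoMoveBlock, hdiv]
        split_ifs <;> omega
      · rw [hfwd q r s hr h]
        simp only [twoMoveBlock, hsmall (r - s) (by omega)]
        split_ifs <;> omega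
  · intro n k hk
    obtain ⟨q, r, hr, rfl⟩ := hn n
    simp only [hmod q r hr] at hk
    rcases lt_or_ge r a with h | h
    · simp only [twoMoveBlock, hsmall r h] at hk
      split_ifs at hk <;> omega
    · by_cases hkb : b ≤ r ∧ k = 0
      · refine ⟨b, by simp, by omega, by omega, ?_⟩
        rw [hfwd q r b hr hkb.1]
        simp only [twoMoveBlock, hsmall (r - b) (by omega)]
        split_ifs <;> omega
      · refine ⟨a, by simp, ha, by omega, ?_⟩
        rw [hfwd q r a hr h]
        obtain ⟨t, rfl⟩ := Nat.exists_eq_add_of_le' h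
        simp only [twoMoveBlock, hdiv, Nat.add_sub_cancel] at hk ⊢
        split_ifs at hk ⊢ <;> omega

theorem subG_pair_add_mul {a b : ℕ} (ha : 0 < a) (hb : 2 * a < b) (n q : ℕ) :
    subG {a, b} (n + q * (a + b)) = subG {a, b} n := by
  rw [subG_pair ha hb, subG_pair ha hb, Nat.add_mul_mod_self_right]

theorem subG_pair_eq_zero {a b m : ℕ} (ha : 0 < a) (hb : 2 * a < b) (hm : m < b)
    (hev : (m / a) % 2 = 0) : subG {a, b} m = 0 := by
  rw [subG_pair ha hb, Nat.mod_eq_of_lt (by omega), twoMoveBlock, if_pos hm, hev]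

/-- A distance `r < b` not separating two zeros of the nim-value sequence is either an odd multiple
of `a` or exceeds `b - a`. -/
theorem odd_div_of_not_zeros {a b r : ℕ} (ha : 0 < a) (hb : 2 * a < b) (hr : r < b)
    (h : ∀ m, subG {a, b} m = 0 → subG {a, b} (m + r) ≠ 0) :
    (r / a) % 2 = 1 ∧ (a ∣ r ∨ b ≤ a * (r / a + 1)) := by
  have h0 : subG {a, b} 0 = 0 := subG_pair_eq_zero ha hb (by omega) (by simp)
  have hodd : (r / a) % 2 = 1 := by
    by_contra hne
    exact h 0 h0 (by rw [zero_add]; exact subG_pair_eq_zero ha hb hr (by omega))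
  refine ⟨hodd, ?_⟩
  by_contra! hcon
  obtain ⟨hd, hlt⟩ := hcon
  have he : 0 < r % a := Nat.pos_of_ne_zero fun he => hd (Nat.dvd_of_mod_eq_zero he)
  have hea := Nat.mod_lt r ha
  have hsum : a - r % a + r = a * (r / a + 1) := by
    have := Nat.mod_add_div r a
    rw [Nat.mul_succ]
    omega
  refine h (a - r % a) (subG_pair_eq_zero ha hb (by omega) ?_) ?_
  · rw [Nat.div_eq_of_lt (by omega)]
  · rw [hsum]
    refine subG_pair_eq_zero ha hb hlt ?_
    rw [Nat.mul_div_cancel_left _ ha]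
    omega

theorem eq_or_eq_of_not_zeros {a b r : ℕ} (ha : 0 < a) (hcop : Nat.Coprime a b)
    (hb : 2 * a < b) (ha1 : a = 1 → Even b) (hr : r < a + b)
    (h : ∀ m, subG {a, b} m = 0 → subG {a, b} (m + r) ≠ 0) : r = a ∨ r = b := by
  have h0 : subG {a, b} 0 = 0 := subG_pair_eq_zero ha hb (by omega) (by simp)
  have hr0 : 0 < r := Nat.pos_of_ne_zero (by rintro rfl; exact h 0 h0 h0)
  obtain ⟨r', hr'⟩ := Nat.exists_eq_add_of_le hr.le
  have h' : ∀ m, subG {a, b} m = 0 → subG {a, b} (m + r') ≠ 0 := fun m hm hm' => by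
    refine h _ hm' ?_
    rw [show m + r' + r = m + 1 * (a + b) by omega, subG_pair_add_mul ha hb, hm]
  have near : ∀ {x y : ℕ}, a + b = x + y → x < b → y < b → b ≤ a * (x / a + 1) →
      (y / a) % 2 = 1 → (a ∣ y ∨ b ≤ a * (y / a + 1)) → y = a := by
    intro x y hxy hx hy hbx hodd hor
    have hx1 := Nat.mod_add_div x a
    have hy1 := Nat.mod_add_div y a
    rw [Nat.mul_succ] at hbx
    have hy2 : y / a < 2 ∨ y = 2 * a := by
      rcases Nat.lt_or_ge y (2 * a) with hlt | hge
      · exact Or.inl ((Nat.div_lt_iff_lt_mul ha).2 hlt)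
      · right; omega
    rcases hy2 with hy2 | rfl
    · have hy3 : y / a = 1 := by rwa [Nat.mod_eq_of_lt hy2] at hodd
      rw [hy3] at hor hy1
      rcases hor with hd | hd
      · have := Nat.mod_eq_zero_of_dvd hd
        omega
      · omega
    · rw [Nat.mul_div_cancel _ ha] at hodd
      omega
  by_cases hrb : r < b
  · obtain ⟨ho, hor⟩ := odd_div_of_not_zeros ha hb hrb h
    by_cases hrb' : r' < b
    · obtain ⟨ho', hor'⟩ := odd_div_of_not_zeros ha hb hrb' h'
      rcases hor with hd | hd
      · rcases hor' with hd' | hd'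
        · have hab : a ∣ b := (Nat.dvd_add_right (dvd_refl a)).1 (hr' ▸ dvd_add hd hd')
          have hone : a = 1 := Nat.Coprime.eq_one_of_dvd hcop hab
          obtain ⟨k, hk⟩ := ha1 hone
          subst hone
          simp only [Nat.div_one] at ho ho'
          omega
        · exact Or.inl (near (by omega) hrb' hrb hd' ho (Or.inl hd))
      · have := near hr' hrb hrb' hd ho' hor'
        right; omega
    · rcases Nat.lt_or_ge r a with hlt | hge
      · rw [Nat.div_eq_of_lt hlt] at ho
        omega
      · left; omega
  · obtain ⟨ho', -⟩ := odd_div_of_not_zeros ha hb (by omega) h'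
    rcases Nat.lt_or_ge r' a with hlt | hge
    · rw [Nat.div_eq_of_lt hlt] at ho'
      omega
    · right; omega

/-- Ho, non-expandability of two-move games: for coprime `a < b` with
`b > 2a` (and `b` even if `a = 1`), `S = {a, b}` is non-expandable: adjoining `c`
preserves the nim-value sequence iff `c = a + n(a+b)` or `c = b + n(a+b)`. -/
theorem ho_nonexpandable (a b : ℕ) (ha : 0 < a) (hab : a < b)
    (hcop : Nat.Coprime a b) (hb2a : 2 * a < b) (ha1 : a = 1 → Even b) :
    ∀ c : ℕ, 0 < c →
      ((∀ n : ℕ, subG (insert c {a, b}) n = subG {a, b} n) ↔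
        ∃ n : ℕ, c = a + n * (a + b) ∨ c = b + n * (a + b)) := by
  intro c hc
  rw [subG_insert_eq_iff _ hc]
  constructor
  · intro h
    have hc' : c = c % (a + b) + c / (a + b) * (a + b) := (Nat.mod_add_div' c (a + b)).symm
    refine ⟨c / (a + b), ?_⟩
    have hr : c % (a + b) = a ∨ c % (a + b) = b := by
      refine eq_or_eq_of_not_zeros ha hcop hb2a ha1 (Nat.mod_lt _ (by omega)) fun m hm hm' => ?_
      apply h m
      rw [hc', ← add_assoc, subG_pair_add_mul ha hb2a, hm, hm']
    rcases hr with hr | hr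
    · left; rwa [hr] at hc'
    · right; rwa [hr] at hc'
  · rintro ⟨q, rfl | rfl⟩ m
    · rw [← add_assoc, subG_pair_add_mul ha hb2a]
      simpa using subG_sub_ne {a, b} (by simp) ha (Nat.le_add_left a m)
    · rw [← add_assoc, subG_pair_add_mul ha hb2a]
      simpa using subG_sub_ne {a, b} (by simp) (ha.trans hab) (Nat.le_add_left b m)
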